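/- Let k be an algebraically closed field of prime characteristic p > 3. Then the trivial module k (the one-dimensional module on which every element of S_{2p} acts as the identity), regarded as a module over Λ_k(p, 2p), has infinite projective dimension over Λ_k(p, 2p). -/

import Mathlib

universe u

/-- `PDimLE A n M`: the `A`-module `M` has projective dimension at most `n`,
witnessed by a projective resolution of length at most `n`. -/
def PDimLE (A : Type u) [Ring A] : ℕ → (M : Type u) → [AddCommGroup M] → [Module A M] → Prop
  | 0, M, _, _ => Module.Projective A M
  | n + 1, M, _, _ =>
      ∃ (P : Type u) (_ : AddCommGroup P) (_ : Module A P) (f : P →ₗ[A] M),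
        Module.Projective A P ∧ Function.Surjective f ∧ PDimLE A n (LinearMap.ker f)

/-- The representation of the symmetric group `S_d` on the `d`-th tensor power of `V = k^n`
by place permutations; the tensor power `V^{⊗ d}` is realised as the free `k`-module on the
set of multi-indices `Fin d → Fin n`, i.e. as the functions `(Fin d → Fin n) → k`. -/
def placePerm (k : Type u) [Field k] (n d : ℕ) :
    Representation k (Equiv.Perm (Fin d)) ((Fin d → Fin n) → k) where
  toFun σ :=
    { toFun := fun f v => f (v ∘ σ)
      map_add' := fun _ _ => rfl
      map_smul' := fun _ _ => rfl }
  map_one' := by ext f v; rfl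
  map_mul' := fun σ τ => by ext f v; rfl

/-- The group algebra of the symmetric group on `d` letters over `k`. -/
abbrev SymGroupAlgebra (k : Type u) [Field k] (d : ℕ) : Type u :=
  MonoidAlgebra k (Equiv.Perm (Fin d))

/-- The tensor space `V^{⊗ d}`, `V = k^n`, as a module over the group algebra of `S_d`
(the symmetric group acting by place permutations). -/
def TensorSpace (k : Type u) [Field k] (n d : ℕ) : Type u := (Fin d → Fin n) → k

instance (k : Type u) [Field k] (n d : ℕ) : AddCommGroup (TensorSpace k n d) :=
  inferInstanceAs (AddCommGroup ((Fin d → Fin n) → k))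

instance (k : Type u) [Field k] (n d : ℕ) : Module k (TensorSpace k n d) :=
  inferInstanceAs (Module k ((Fin d → Fin n) → k))

noncomputable instance (k : Type u) [Field k] (n d : ℕ) :
    Module (SymGroupAlgebra k d) (TensorSpace k n d) where
  smul r t := (placePerm k n d).asAlgebraHom r t
  one_smul t := by show (placePerm k n d).asAlgebraHom 1 t = t; rw [map_one]; rfl
  mul_smul r s t := by
    show (placePerm k n d).asAlgebraHom (r * s) t
      = (placePerm k n d).asAlgebraHom r ((placePerm k n d).asAlgebraHom s t)
    rw [map_mul]; rfl
  smul_zero r := map_zero ((placePerm k n d).asAlgebraHom r)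
  smul_add r t₁ t₂ := map_add ((placePerm k n d).asAlgebraHom r) t₁ t₂
  add_smul r s t := by
    show (placePerm k n d).asAlgebraHom (r + s) t
      = (placePerm k n d).asAlgebraHom r t + (placePerm k n d).asAlgebraHom s t
    rw [map_add]; rfl
  zero_smul t := by show (placePerm k n d).asAlgebraHom 0 t = 0; rw [map_zero]; rfl

lemma tensorSpace_smul_def (k : Type u) [Field k] {n d : ℕ} (r : SymGroupAlgebra k d)
    (t : TensorSpace k n d) : r • t = (placePerm k n d).asAlgebraHom r t := rfl

/-- The Schur algebra `S_k(n, d)`: the endomorphism algebra of the tensor space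
`(k^n)^{⊗ d}` as a module over the group algebra of the symmetric group `S_d`.
The tensor space is a left module over it by evaluation. -/
noncomputable abbrev SchurAlgebra (k : Type u) [Field k] (n d : ℕ) : Type u :=
  Module.End (SymGroupAlgebra k d) (TensorSpace k n d)

/-- The congruence relation on the group algebra `k S_d` corresponding to the two-sided
ideal `Ann_{k S_d}((k^n)^{⊗ d})`, the annihilator of the tensor space. -/
noncomputable def annihilatorCon (k : Type u) [Field k] (n d : ℕ) :
    RingCon (SymGroupAlgebra k d) where
  r a b := ∀ t : TensorSpace k n d, a • t = b • t
  iseqv :=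
    ⟨fun _ _ => rfl, fun h t => (h t).symm, fun h₁ h₂ t => (h₁ t).trans (h₂ t)⟩
  mul' := fun {a b c d'} h₁ h₂ t => by
    show (a * c) • t = (b * d') • t
    rw [mul_smul, mul_smul, h₂ t, h₁ (d' • t)]
  add' := fun {a b c d'} h₁ h₂ t => by
    show (a + c) • t = (b + d') • t
    rw [add_smul, add_smul, h₁ t, h₂ t]

/-- The algebra `Λ_k(n, d)`: the quotient of the group algebra of the symmetric group `S_d`
by the annihilator of the tensor space `(k^n)^{⊗ d}`. -/
noncomputable def LambdaAlgebra (k : Type u) [Field k] (n d : ℕ) : Type u :=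
  (annihilatorCon k n d).Quotient

noncomputable instance (k : Type u) [Field k] (n d : ℕ) : Ring (LambdaAlgebra k n d) :=
  inferInstanceAs (Ring (annihilatorCon k n d).Quotient)

/-- The tensor space is a module over `Λ_k(n, d)`. -/
noncomputable instance (k : Type u) [Field k] (n d : ℕ) :
    Module (LambdaAlgebra k n d) (TensorSpace k n d) where
  smul a t := Quotient.liftOn a (fun r => r • t) (fun _ _ h => h t)
  one_smul t := one_smul (SymGroupAlgebra k d) t
  mul_smul a b t := Quotient.inductionOn₂ a b (fun r s => mul_smul r s t)
  smul_zero a := Quotient.inductionOn a (fun r => smul_zero r)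
  smul_add a t₁ t₂ := Quotient.inductionOn a (fun r => smul_add r t₁ t₂)
  add_smul a b t := Quotient.inductionOn₂ a b (fun r s => add_smul r s t)
  zero_smul t := zero_smul (SymGroupAlgebra k d) t

/-- `Λ_k(n, d)` is a `k`-algebra. -/
noncomputable instance (k : Type u) [Field k] (n d : ℕ) : Algebra k (LambdaAlgebra k n d) :=
  RingHom.toAlgebra'
    ((RingCon.mk' (annihilatorCon k n d)).comp (algebraMap k (SymGroupAlgebra k d)))
    (fun c x => by
      refine Quotient.inductionOn x (fun r => ?_)
      show ((algebraMap k (SymGroupAlgebra k d) c * r : SymGroupAlgebra k d) :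
          (annihilatorCon k n d).Quotient)
        = ((r * algebraMap k (SymGroupAlgebra k d) c : SymGroupAlgebra k d) :
          (annihilatorCon k n d).Quotient)
      exact congrArg _ (Algebra.commutes c r))

/-- The augmentation map (sum of coefficients) on the group algebra of `S_d`. -/
noncomputable def augmentation (k : Type u) [Field k] (d : ℕ) : SymGroupAlgebra k d →ₐ[k] k :=
  MonoidAlgebra.lift k k (Equiv.Perm (Fin d)) 1

/-- The basis vector `e ⊗ ⋯ ⊗ e` of the tensor space, i.e. the delta function at the
constant multi-index `0`. -/
noncomputable def deltaConst (k : Type u) [Field k] (n d : ℕ) [NeZero n] : TensorSpace k n d :=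
  fun v => if v = (fun _ => (0 : Fin n)) then (1 : k) else 0

lemma smul_deltaConst_eval (k : Type u) [Field k] (n d : ℕ) [NeZero n]
    (a : SymGroupAlgebra k d) :
    (a • deltaConst k n d) (fun _ => (0 : Fin n)) = augmentation k d a := by
  induction a using MonoidAlgebra.induction_linear with
  | zero => rw [zero_smul, map_zero]; rfl
  | add f g hf hg => rw [add_smul, map_add, ← hf, ← hg]; rfl
  | single σ c =>
      rw [tensorSpace_smul_def, Representation.asAlgebraHom_single]
      show c • ((placePerm k n d σ) (deltaConst k n d) (fun _ => (0 : Fin n))) = _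
      have h1 : (placePerm k n d σ) (deltaConst k n d) (fun _ => (0 : Fin n))
          = deltaConst k n d (fun _ => (0 : Fin n)) := rfl
      have h2 : deltaConst k n d (fun _ => (0 : Fin n)) = 1 := if_pos rfl
      rw [h1, h2]
      show c * 1 = augmentation k d (MonoidAlgebra.single σ c)
      rw [mul_one]
      unfold augmentation
      rw [MonoidAlgebra.lift_single]
      simp

/-- The augmentation descends to `Λ_k(n, d)` (the trivial module embeds into the tensor
space as the span of `e ⊗ ⋯ ⊗ e`, so the annihilator of the tensor space acts by zero
on the trivial module). -/
noncomputable def augmentationLambda (k : Type u) [Field k] (n d : ℕ) [NeZero n] :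
    LambdaAlgebra k n d →+* k where
  toFun a := Quotient.liftOn a (fun r => augmentation k d r)
    (fun r s h => by
      show augmentation k d r = augmentation k d s
      rw [← smul_deltaConst_eval k n d r, ← smul_deltaConst_eval k n d s,
        h (deltaConst k n d)])
  map_one' := map_one (augmentation k d)
  map_mul' a b := Quotient.inductionOn₂ a b (fun r s => map_mul (augmentation k d) r s)
  map_zero' := map_zero (augmentation k d)
  map_add' a b := Quotient.inductionOn₂ a b (fun r s => map_add (augmentation k d) r s)

/-- The trivial module: the one-dimensional module `k` on which every element of the
symmetric group acts as the identity, viewed as a module over `Λ_k(n, d)`. -/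
def TrivialModule (k : Type u) [Field k] (n d : ℕ) : Type u := k

instance (k : Type u) [Field k] (n d : ℕ) : AddCommGroup (TrivialModule k n d) :=
  inferInstanceAs (AddCommGroup k)

noncomputable instance (k : Type u) [Field k] (n d : ℕ) [NeZero n] :
    Module (LambdaAlgebra k n d) (TrivialModule k n d) :=
  Module.compHom k (augmentationLambda k n d)

/-- For a ring `A` with elements `e`, `c`, `s`, the `2`-periodic complex with differentials
`s` and `c - 1` on the part `e M` of the `A`-module `M` is exact. -/
def TateAcyclic {A : Type*} [Ring A] (e c s : A) (M : Type*) [AddCommGroup M] [Module A M] :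
    Prop :=
  (∀ m : M, e • m = m → (c - 1) • m = 0 → ∃ m' : M, m = s • e • m') ∧
    ∀ m : M, e • m = m → s • m = 0 → ∃ m' : M, m = (c - 1) • e • m'

section TateAcyclic

variable {A : Type*} [Ring A] {e : A}

lemma exists_preimage_of_exact_ker {M P : Type*} [AddCommGroup M] [Module A M]
    [AddCommGroup P] [Module A P] {a b : A} (he : e * e = e) (ha : a * e = e * a)
    (hba : b * a = 0) (f : P →ₗ[A] M) (hf : Function.Surjective f)
    (hK : ∀ m : LinearMap.ker f, e • m = m → b • m = 0 →
      ∃ m' : LinearMap.ker f, m = a • e • m')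
    (hP : ∀ m : P, e • m = m → a • m = 0 → ∃ m' : P, m = b • e • m')
    (m : M) (hem : e • m = m) (ham : a • m = 0) : ∃ m' : M, m = b • e • m' := by
  obtain ⟨q, rfl⟩ := hf m
  have hker : a • e • q ∈ LinearMap.ker f := by
    rw [LinearMap.mem_ker, map_smul, map_smul, hem, ham]
  obtain ⟨r, hr⟩ := hK ⟨a • e • q, hker⟩
    (Subtype.ext (by
      show e • a • e • q = a • e • q
      rw [smul_smul, ← ha, ← smul_smul, smul_smul e e, he]))
    (Subtype.ext (by
      show b • a • e • q = 0
      rw [smul_smul, hba, zero_smul]))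
  have hr' : a • e • q = a • e • (r : P) := congrArg Subtype.val hr
  obtain ⟨p, hp⟩ := hP (e • q - e • (r : P))
    (by rw [smul_sub, smul_smul, smul_smul, he]) (by rw [smul_sub, hr', sub_self])
  refine ⟨f p, ?_⟩
  have h := congrArg f hp
  have hr0 : f (r : P) = 0 := r.2
  rwa [map_sub, map_smul, map_smul, hr0, smul_zero, sub_zero, hem, map_smul, map_smul] at h

lemma exists_preimage_of_projective {P : Type*} [AddCommGroup P] [Module A P]
    [Module.Projective A P] {a b : A}
    (h : ∀ x : A, e * x = x → a * x = 0 → ∃ y : A, x = b * (e * y))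
    (m : P) (hem : e • m = m) (ham : a • m = 0) : ∃ m' : P, m = b • e • m' := by
  obtain ⟨s, hs⟩ := Module.Projective.out (R := A) (P := P)
  have key : ∀ x : A, ∃ y : A, e * x = x → a * x = 0 → x = b * (e * y) := fun x => by
    by_cases h' : e * x = x ∧ a * x = 0
    · obtain ⟨y, hy⟩ := h x h'.1 h'.2
      exact ⟨y, fun _ _ => hy⟩
    · exact ⟨0, fun h1 h2 => absurd ⟨h1, h2⟩ h'⟩
  choose φ hφ using key
  classical
  let y : P →₀ A := (s m).mapRange (fun x => if x = 0 then 0 else φ x) (if_pos rfl)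
  have hy : s m = b • e • y := by
    ext i
    have h1 : e * s m i = s m i := by
      conv_rhs => rw [← hem, map_smul]
      rfl
    have h2 : a * s m i = 0 := by
      have : s (a • m) i = 0 := by rw [ham, map_zero]; rfl
      rwa [map_smul] at this
    show s m i = b * (e * (if s m i = 0 then 0 else φ (s m i)))
    split_ifs with h0
    · rw [h0, mul_zero, mul_zero]
    · exact hφ _ h1 h2
  refine ⟨Finsupp.linearCombination A id y, ?_⟩
  rw [← map_smul, ← map_smul, ← hy]
  exact (hs m).symm

variable {c s : A}

lemma TateAcyclic.of_ker {M P : Type*} [AddCommGroup M] [Module A M]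
    [AddCommGroup P] [Module A P] (he : e * e = e) (hc : c * e = e * c) (hs : s * e = e * s)
    (hsc : s * (c - 1) = 0) (hcs : (c - 1) * s = 0) (f : P →ₗ[A] M)
    (hf : Function.Surjective f) (hK : TateAcyclic e c s (LinearMap.ker f))
    (hP : TateAcyclic e c s P) : TateAcyclic e c s M :=
  have hc' : (c - 1) * e = e * (c - 1) := by rw [sub_mul, mul_sub, hc, one_mul, mul_one]
  ⟨exists_preimage_of_exact_ker he hc' hsc f hf hK.2 hP.1,
    exists_preimage_of_exact_ker he hs hcs f hf hK.1 hP.2⟩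

lemma TateAcyclic.of_projective (hA : TateAcyclic e c s A) (P : Type*) [AddCommGroup P]
    [Module A P] [Module.Projective A P] : TateAcyclic e c s P :=
  ⟨exists_preimage_of_projective hA.1, exists_preimage_of_projective hA.2⟩

end TateAcyclic

lemma TateAcyclic.of_pdimLE {A : Type u} [Ring A] {e c s : A} (he : e * e = e)
    (hc : c * e = e * c) (hs : s * e = e * s) (hsc : s * (c - 1) = 0) (hcs : (c - 1) * s = 0)
    (hA : TateAcyclic e c s A) :
    ∀ (n : ℕ) (M : Type u) [AddCommGroup M] [Module A M], PDimLE A n M → TateAcyclic e c s M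
  | 0, M, _, _, h => by
      have : Module.Projective A M := h
      exact hA.of_projective M
  | n + 1, M, _, _, h => by
      obtain ⟨P, _, _, f, hP, hf, hK⟩ := h
      exact .of_ker he hc hs hsc hcs f hf (of_pdimLE he hc hs hsc hcs hA n _ hK)
        (hA.of_projective P)

section SubgroupAverage

variable (k : Type*) [Field k] {G : Type*} [Group G]

/-- The average of the elements of a finite subgroup in the group algebra. -/
noncomputable def subgroupAverage (H : Subgroup G) [Fintype H] : MonoidAlgebra k G :=
  (Fintype.card H : k)⁻¹ • ∑ h : H, MonoidAlgebra.single (h : G) 1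

variable {k}

lemma single_mul_subgroupAverage (H : Subgroup G) [Fintype H] (h : H) :
    MonoidAlgebra.single (h : G) 1 * subgroupAverage k H = subgroupAverage k H := by
  rw [subgroupAverage, mul_smul_comm, Finset.mul_sum]
  congr 1
  refine Fintype.sum_equiv (Equiv.mulLeft h) _ _ fun x => ?_
  rw [MonoidAlgebra.single_mul_single, one_mul]
  rfl

lemma subgroupAverage_mul_self (H : Subgroup G) [Fintype H] (hH : (Fintype.card H : k) ≠ 0) :
    subgroupAverage k H * subgroupAverage k H = subgroupAverage k H := by
  conv_lhs => enter [1]; rw [subgroupAverage]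
  rw [smul_mul_assoc, Finset.sum_mul, Finset.sum_congr rfl fun h _ =>
    single_mul_subgroupAverage H h, Finset.sum_const, Finset.card_univ, ← Nat.cast_smul_eq_nsmul k,
    smul_smul, inv_mul_cancel₀ hH, one_smul]

lemma single_mul_subgroupAverage_comm (H : Subgroup G) [Fintype H] (g : G)
    (hg : ∀ h, g * h * g⁻¹ ∈ H ↔ h ∈ H) :
    MonoidAlgebra.single g 1 * subgroupAverage k H
      = subgroupAverage k H * MonoidAlgebra.single g 1 := by
  rw [subgroupAverage, mul_smul_comm, smul_mul_assoc, Finset.mul_sum, Finset.sum_mul]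
  congr 1
  refine Fintype.sum_equiv ((MulAut.conj g).toEquiv.subtypeEquiv fun h => (hg h).symm) _ _
    fun x => ?_
  rw [MonoidAlgebra.single_mul_single, MonoidAlgebra.single_mul_single]
  congr 1
  simp

end SubgroupAverage

section Contraction

variable {k : Type*} [Field k] {G : Type*}

/-- Pointwise multiplication of the elements of the group algebra by a function on the group. -/
noncomputable def mulCoeff (θ : G → k) : MonoidAlgebra k G →+ MonoidAlgebra k G where
  toFun a := a.coeff.sum fun g r => MonoidAlgebra.single g (θ g * r)
  map_zero' := Finsupp.sum_zero_index
  map_add' _ _ := Finsupp.sum_add_index' (fun _ => by simp) fun _ _ _ => by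
    rw [mul_add, MonoidAlgebra.single_add]

lemma mulCoeff_single (θ : G → k) (g : G) (r : k) :
    mulCoeff θ (MonoidAlgebra.single g r) = MonoidAlgebra.single g (θ g * r) :=
  Finsupp.sum_single_index (h := fun g r => MonoidAlgebra.single g (θ g * r))
    (by rw [mul_zero, MonoidAlgebra.single_zero])

variable [Group G]

lemma sum_conj_mulCoeff {θ : G → k} {g : G} {n : ℕ}
    (hθ : ∀ x, ∑ i ∈ Finset.range n, θ ((g ^ i)⁻¹ * x) = 1) (a : MonoidAlgebra k G) :
    ∑ i ∈ Finset.range n, MonoidAlgebra.single (g ^ i) 1 *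
      mulCoeff θ (MonoidAlgebra.single (g ^ i)⁻¹ 1 * a) = a := by
  induction a using MonoidAlgebra.induction_linear with
  | zero => simp
  | add x y hx hy => simp only [mul_add, map_add, Finset.sum_add_distrib, hx, hy]
  | single x r =>
      simp only [MonoidAlgebra.single_mul_single, mulCoeff_single, one_mul, mul_inv_cancel_left]
      simp only [← MonoidAlgebra.singleAddHom_apply]
      rw [← map_sum, ← Finset.sum_mul, hθ, one_mul]

lemma single_pow_one (g : G) (i : ℕ) :
    MonoidAlgebra.single (g ^ i) (1 : k) = MonoidAlgebra.single g 1 ^ i := by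
  rw [MonoidAlgebra.single_pow, one_pow]

lemma exists_eq_geom_sum_mul {θ : G → k} {g : G} {n : ℕ}
    (hθ : ∀ x, ∑ i ∈ Finset.range n, θ ((g ^ i)⁻¹ * x) = 1) {a : MonoidAlgebra k G}
    (ha : MonoidAlgebra.single g 1 * a = a) :
    ∃ b, a = (∑ i ∈ Finset.range n, MonoidAlgebra.single g 1 ^ i) * b := by
  refine ⟨mulCoeff θ a, ?_⟩
  have hpow : ∀ i : ℕ, MonoidAlgebra.single (g ^ i) 1 * a = a := fun i => by
    induction i with
    | zero => rw [pow_zero]; exact one_mul a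
    | succ i ih => rw [single_pow_one, pow_succ, mul_assoc, ha, ← single_pow_one, ih]
  have hinv : ∀ i : ℕ, MonoidAlgebra.single (g ^ i)⁻¹ 1 * a = a := fun i => by
    conv_lhs => rw [← hpow i, ← mul_assoc, MonoidAlgebra.single_mul_single, inv_mul_cancel, one_mul]
    exact one_mul a
  conv_lhs => rw [← sum_conj_mulCoeff hθ a]
  simp only [hinv, single_pow_one, Finset.sum_mul]

lemma exists_eq_sub_one_mul {θ : G → k} {g : G} {n : ℕ} (hg : g ^ n = 1)
    (hθ : ∀ x, ∑ i ∈ Finset.range n, θ ((g ^ i)⁻¹ * x) = 1) {a : MonoidAlgebra k G}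
    (ha : (∑ i ∈ Finset.range n, MonoidAlgebra.single g 1 ^ i) * a = 0) :
    ∃ b, a = (MonoidAlgebra.single g 1 - 1) * b := by
  have hsum : ∑ i ∈ Finset.range n, MonoidAlgebra.single (g ^ i)⁻¹ 1 * a = 0 := by
    rcases n with _ | n
    · simp
    rw [Finset.sum_mul] at ha
    rw [Finset.sum_range_succ'] at ha ⊢
    rw [← ha, ← Finset.sum_range_reflect]
    congr 1
    · refine Finset.sum_congr rfl fun i hi => ?_
      rw [← single_pow_one]
      congr 2
      rw [inv_eq_iff_mul_eq_one, ← pow_add, ← hg]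
      congr 1
      have := Finset.mem_range.mp hi
      omega
    · simp [MonoidAlgebra.one_def]
  have hsum' : ∑ i ∈ Finset.range n,
      mulCoeff θ (MonoidAlgebra.single (g ^ i)⁻¹ 1 * a) = 0 := by
    rw [← map_sum, hsum, map_zero]
  refine ⟨∑ i ∈ Finset.range n, (∑ j ∈ Finset.range i, MonoidAlgebra.single g 1 ^ j) *
    mulCoeff θ (MonoidAlgebra.single (g ^ i)⁻¹ 1 * a), ?_⟩
  rw [Finset.mul_sum]
  simp only [← mul_assoc, mul_geom_sum]
  simp only [sub_mul, Finset.sum_sub_distrib, one_mul, hsum', sub_zero, ← single_pow_one]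
  exact (sum_conj_mulCoeff hθ a).symm

end Contraction

/-- The permutations that preserve a word. -/
def wordStabilizer {α β : Type*} (w : α → β) : Subgroup (Equiv.Perm α) where
  carrier := {σ | w ∘ σ = w}
  mul_mem' {σ τ} hσ hτ := by
    show (w ∘ σ) ∘ τ = w
    rw [show w ∘ σ = w from hσ]
    exact hτ
  one_mem' := rfl
  inv_mem' {σ} hσ := by
    show w ∘ ⇑σ⁻¹ = w
    conv_lhs => rw [← show w ∘ σ = w from hσ]
    ext x
    simp

lemma mem_wordStabilizer {α β : Type*} {w : α → β} {σ : Equiv.Perm α} :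
    σ ∈ wordStabilizer w ↔ w ∘ σ = w := Iff.rfl

/-- The average over the stabilizer of a word in `n` letters annihilates the annihilator of the
tensor space. -/
lemma subgroupAverage_wordStabilizer_mul_eq_zero (k : Type u) [Field k] {n d : ℕ}
    (w : Fin d → Fin n) [Fintype (wordStabilizer w)] {a : SymGroupAlgebra k d}
    (ha : ∀ t : TensorSpace k n d, a • t = 0) :
    subgroupAverage k (wordStabilizer w) * a = 0 := by
  let δ (v : Fin d → Fin n) : TensorSpace k n d := fun u => if u = v then 1 else 0
  have key : ∀ (b : SymGroupAlgebra k d) (τ : Equiv.Perm (Fin d)),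
      ((∑ h : wordStabilizer w, MonoidAlgebra.single (h : Equiv.Perm (Fin d)) 1) * b).coeff τ
        = (b • δ (w ∘ τ)) w := fun b τ => by
    induction b using MonoidAlgebra.induction_linear with
    | zero => rw [mul_zero, zero_smul]; rfl
    | add x y hx hy =>
        rw [mul_add, add_smul, MonoidAlgebra.coeff_add, Finsupp.add_apply, hx, hy]
        rfl
    | single σ r =>
        rw [tensorSpace_smul_def, Representation.asAlgebraHom_single]
        show _ = r * (if w ∘ σ = w ∘ τ then 1 else 0)
        simp only [Finset.sum_mul, MonoidAlgebra.single_mul_single, one_mul,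
          MonoidAlgebra.coeff_sum, Finsupp.finsetSum_apply]
        by_cases hστ : w ∘ σ = w ∘ τ
        · have hmem : τ * σ⁻¹ ∈ wordStabilizer w := by
            show w ∘ (τ * σ⁻¹ : Equiv.Perm (Fin d)) = w
            rw [Equiv.Perm.coe_mul, ← Function.comp_assoc, ← hστ]
            ext x
            simp
          rw [if_pos hστ, mul_one, Finset.sum_eq_single ⟨τ * σ⁻¹, hmem⟩]
          · simp
          · intro h _ hne
            refine Finsupp.single_eq_of_ne fun h' => hne (Subtype.ext ?_)
            simp [h']
          · simp
        · rw [if_neg hστ, mul_zero]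
          refine Finset.sum_eq_zero fun h _ => Finsupp.single_eq_of_ne fun h' => hστ ?_
          rw [h', Equiv.Perm.coe_mul, ← Function.comp_assoc, mem_wordStabilizer.mp h.2]
  rw [subgroupAverage, smul_mul_assoc]
  suffices h : (∑ h : wordStabilizer w, MonoidAlgebra.single (h : Equiv.Perm (Fin d)) 1) * a = 0 by
    rw [h, smul_zero]
  ext τ
  rw [key, ha]
  rfl

/-- The quotient map from the group algebra onto `Λ_k(n, d)`. -/
noncomputable def toLambda (k : Type u) [Field k] (n d : ℕ) :
    SymGroupAlgebra k d →+* LambdaAlgebra k n d :=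
  (annihilatorCon k n d).mk'

lemma toLambda_surjective (k : Type u) [Field k] (n d : ℕ) :
    Function.Surjective (toLambda k n d) :=
  (annihilatorCon k n d).mk'_surjective

lemma toLambda_eq_zero {k : Type u} [Field k] {n d : ℕ} {a : SymGroupAlgebra k d} :
    toLambda k n d a = 0 ↔ ∀ t : TensorSpace k n d, a • t = 0 := by
  rw [← map_zero (toLambda k n d)]
  refine (RingCon.eq (annihilatorCon k n d)).trans ?_
  show (∀ t : TensorSpace k n d, a • t = (0 : SymGroupAlgebra k d) • t) ↔ _
  simp only [zero_smul]

lemma exists_lambda_preimage {k : Type u} [Field k] {n d : ℕ} {e a b : SymGroupAlgebra k d}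
    (he : e * e = e) (ha : a * e = e * a) (hb : b * e = e * b)
    (hann : ∀ x, toLambda k n d x = 0 → e * x = 0)
    (hab : ∀ x, a * x = 0 → ∃ y, x = b * y) (x : LambdaAlgebra k n d)
    (hx : toLambda k n d e * x = x) (hax : toLambda k n d a * x = 0) :
    ∃ y, x = toLambda k n d b * (toLambda k n d e * y) := by
  obtain ⟨x, rfl⟩ := toLambda_surjective k n d x
  have h0 : e * (a * x) = 0 := hann _ (by rw [map_mul, hax])
  obtain ⟨y, hy⟩ := hab (e * x) (by rw [← mul_assoc, ha, mul_assoc, h0])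
  refine ⟨toLambda k n d y, ?_⟩
  rw [← hx, ← map_mul, ← map_mul, ← map_mul]
  congr 1
  rw [← mul_assoc, hb, mul_assoc, ← hy, ← mul_assoc, he]

section Rotation

variable (p : ℕ)

/-- The word of length `2 p` in which each of `p` letters appears twice. -/
def pairWord (x : Fin (2 * p)) : Fin p := (finProdFinEquiv.symm x).2

lemma card_wordStabilizer_pairWord [Fintype (wordStabilizer (pairWord p))] :
    Fintype.card (wordStabilizer (pairWord p)) = 2 ^ p := by
  classical
  have h : Fintype.card (wordStabilizer (pairWord p)) =
      Fintype.card {g : Equiv.Perm (Fin (2 * p)) // pairWord p ∘ g = pairWord p} :=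
    Fintype.card_congr (Equiv.refl _)
  rw [h, DomMulAct.stabilizer_card]
  have hfib : ∀ i : Fin p, Fintype.card {x // pairWord p x = i} = 2 := fun i => by
    refine (Fintype.card_congr ?_).trans (Fintype.card_fin 2)
    exact
      { toFun := fun x => (finProdFinEquiv.symm x.1).1
        invFun := fun a => ⟨finProdFinEquiv (a, i), by rw [pairWord, Equiv.symm_apply_apply]⟩
        left_inv := by
          rintro ⟨x, rfl⟩
          exact Subtype.ext (finProdFinEquiv.apply_symm_apply x)
        right_inv := fun a => by simp only [Equiv.symm_apply_apply] }
  simp [hfib]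

variable [NeZero p]

/-- The product of two `p`-cycles that rotates the letters of `pairWord p`. -/
def pairRotation : Equiv.Perm (Fin (2 * p)) :=
  finProdFinEquiv.permCongr ((Equiv.refl (Fin 2)).prodCongr (Equiv.addRight (1 : Fin p)))

lemma pairRotation_pow_apply (i : ℕ) (x : Fin (2 * p)) :
    (pairRotation p ^ i) x = finProdFinEquiv ((finProdFinEquiv.symm x).1, pairWord p x + i • 1) := by
  induction i with
  | zero => simpa [pairWord] using (finProdFinEquiv.apply_symm_apply x).symm
  | succ i ih =>
      rw [pow_succ', Equiv.Perm.mul_apply, ih]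
      simp [pairRotation, succ_nsmul, add_assoc, -finProdFinEquiv_apply_val,
        -finProdFinEquiv_symm_apply]

lemma pairWord_pairRotation_pow (i : ℕ) (x : Fin (2 * p)) :
    pairWord p ((pairRotation p ^ i) x) = pairWord p x + i • 1 := by
  rw [pairRotation_pow_apply, pairWord, Equiv.symm_apply_apply]

lemma pairRotation_pow_self : pairRotation p ^ p = 1 := by
  ext1 x
  have h : p • (1 : Fin p) = 0 := by
    simpa using card_nsmul_eq_zero' (G := Fin p) (x := 1)
  rw [pairRotation_pow_apply, h, add_zero]
  exact finProdFinEquiv.apply_symm_apply x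

lemma conj_pairRotation_mem (h : Equiv.Perm (Fin (2 * p))) :
    pairRotation p * h * (pairRotation p)⁻¹ ∈ wordStabilizer (pairWord p) ↔
      h ∈ wordStabilizer (pairWord p) := by
  have hw : ∀ x, pairWord p (pairRotation p x) = pairWord p x + 1 := fun x => by
    simpa using pairWord_pairRotation_pow p 1 x
  simp only [mem_wordStabilizer, funext_iff, Function.comp_apply, Equiv.Perm.mul_apply, hw]
  refine ⟨fun H x => ?_, fun H x => ?_⟩
  · have := H (pairRotation p x)
    rw [Equiv.Perm.inv_def, Equiv.symm_apply_apply, hw] at this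
    exact add_right_cancel this
  · rw [H, ← hw, Equiv.Perm.inv_def, Equiv.apply_symm_apply]

/-- The indicator function of the permutations that send the first point to a point labelled by
the letter `0`. -/
def firstPointIndicator (k : Type*) [Field k] (σ : Equiv.Perm (Fin (2 * p))) : k :=
  if pairWord p (σ (finProdFinEquiv (0, 0))) = 0 then 1 else 0

lemma sum_firstPointIndicator (k : Type*) [Field k] (σ : Equiv.Perm (Fin (2 * p))) :
    ∑ i ∈ Finset.range p, firstPointIndicator p k ((pairRotation p ^ i)⁻¹ * σ) = 1 := by
  have h : ∀ i : ℕ, firstPointIndicator p k ((pairRotation p ^ i)⁻¹ * σ) =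
      if pairWord p (σ (finProdFinEquiv (0, 0))) = i • 1 then 1 else 0 := fun i => by
    have := pairWord_pairRotation_pow p i ((pairRotation p ^ i)⁻¹ (σ (finProdFinEquiv (0, 0))))
    rw [Equiv.Perm.inv_def, Equiv.apply_symm_apply] at this
    simp only [firstPointIndicator, Equiv.Perm.mul_apply, this, Equiv.Perm.inv_def]
    exact if_congr add_eq_right.symm rfl rfl
  have hval : ∀ i : Fin p, (i : ℕ) • (1 : Fin p) = i := fun i => by
    open Fin.CommRing in
    simp
  simp only [h]
  rw [Finset.sum_range]
  simp [hval]

end Rotation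

/-- Let `k` be an algebraically closed field of prime characteristic `p > 3`. Then the
trivial module `k` (every element of `S_{2p}` acts as the identity), regarded as a module
over `Λ_k(p, 2p)`, has infinite projective dimension. -/
theorem trivialModule_infinite_projDim (k : Type u) [Field k] [IsAlgClosed k] (p : ℕ)
    (hp : p.Prime) [CharP k p] (hp3 : 3 < p) [NeZero p] :
    ∀ n : ℕ, ¬ PDimLE (LambdaAlgebra k p (2 * p)) n (TrivialModule k p (2 * p)) := by
  -- `e Λ = e kS_{2p}` is free over the cyclic group generated by `c`, but `e k = k` is not.
  intro n hn
  classical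
  let e := subgroupAverage k (wordStabilizer (pairWord p))
  let c : SymGroupAlgebra k (2 * p) := MonoidAlgebra.single (pairRotation p) 1
  let s := ∑ i ∈ Finset.range p, c ^ i
  have hcard : (Fintype.card (wordStabilizer (pairWord p)) : k) ≠ 0 := by
    rw [card_wordStabilizer_pairWord, Ne, CharP.cast_eq_zero_iff k p]
    exact fun h => absurd (Nat.le_of_dvd two_pos (hp.dvd_of_dvd_pow h)) (by omega)
  have he : e * e = e := subgroupAverage_mul_self _ hcard
  have hc : c * e = e * c := single_mul_subgroupAverage_comm _ _ (conj_pairRotation_mem p)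
  have hs : s * e = e * s :=
    (Commute.sum_left _ _ _ fun i _ => Commute.pow_left hc i : Commute s e)
  have hcp : c ^ p = 1 := by
    rw [← single_pow_one, pairRotation_pow_self]
    rfl
  have hsc : s * (c - 1) = 0 := by rw [geom_sum_mul, hcp, sub_self]
  have hcs : (c - 1) * s = 0 := by rw [mul_geom_sum, hcp, sub_self]
  have hc' : (c - 1) * e = e * (c - 1) := by rw [sub_mul, mul_sub, hc, one_mul, mul_one]
  have hann : ∀ x, toLambda k p (2 * p) x = 0 → e * x = 0 := fun x hx =>
    subgroupAverage_wordStabilizer_mul_eq_zero k _ (toLambda_eq_zero.mp hx)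
  have hθ := sum_firstPointIndicator p k
  let π := toLambda k p (2 * p)
  have hΛ : TateAcyclic (π e) (π c) (π s) (LambdaAlgebra k p (2 * p)) := by
    constructor
    · rw [← map_one π, ← map_sub]
      exact exists_lambda_preimage he hc' hs hann fun x hx =>
        exists_eq_geom_sum_mul hθ (by rwa [sub_mul, one_mul, sub_eq_zero] at hx)
    · rw [← map_one π, ← map_sub]
      exact exists_lambda_preimage he hs hc' hann fun x hx =>
        exists_eq_sub_one_mul (pairRotation_pow_self p) hθ hx
  have htriv := TateAcyclic.of_pdimLE (by rw [← map_mul, he]) (by rw [← map_mul, hc, map_mul])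
    (by rw [← map_mul, hs, map_mul]) (by rw [← map_one π, ← map_sub, ← map_mul, hsc, map_zero])
    (by rw [← map_one π, ← map_sub, ← map_mul, hcs, map_zero]) hΛ n _ hn
  have hone : ∀ (a : SymGroupAlgebra k (2 * p)) (m : TrivialModule k p (2 * p)),
      augmentation k (2 * p) a = 1 → π a • m = m := fun a m ha => by
    show augmentation k (2 * p) a * (show k from m) = m
    rw [ha]
    exact one_mul (M := k) m
  have hzero : ∀ (a : SymGroupAlgebra k (2 * p)) (m : TrivialModule k p (2 * p)),
      augmentation k (2 * p) a = 0 → π a • m = 0 := fun a m ha => by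
    show augmentation k (2 * p) a * (show k from m) = 0
    rw [ha]
    exact zero_mul (M₀ := k) m
  have haug : ∀ σ : Equiv.Perm (Fin (2 * p)),
      augmentation k (2 * p) (MonoidAlgebra.single σ 1) = 1 := fun σ => by
    simp [augmentation, MonoidAlgebra.lift_single]
  have hae : augmentation k (2 * p) e = 1 := by
    simp only [e, subgroupAverage, map_smul, map_sum, haug, Finset.sum_const, Finset.card_univ,
      nsmul_eq_mul, mul_one, smul_eq_mul]
    exact inv_mul_cancel₀ hcard
  have has : augmentation k (2 * p) s = 0 := by
    simp only [s, c, map_sum, map_pow, haug, one_pow, Finset.sum_const, Finset.card_range,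
      nsmul_eq_mul, mul_one]
    exact CharP.cast_eq_zero k p
  have hc1 : ∀ m : TrivialModule k p (2 * p), (π c - 1) • m = 0 := by
    intro m
    rw [← map_one π, ← map_sub]
    exact hzero _ _ (by rw [map_sub, map_one, haug, sub_self])
  obtain ⟨m, hm⟩ := htriv.1 (1 : k) (hone _ _ hae) (hc1 _)
  exact one_ne_zero (α := k) (hm.trans (hzero _ _ has))
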